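/- The MIMO capacity function C(S) = log det(I + (P/N_t) · H_S H_S†) is submodular: for all subsets S ⊆ T ⊆ {1,...,N_r} and any index a ∉ T, C(S ∪ {a}) − C(S) ≥ C(T ∪ {a}) − C(T). -/

import Mathlib

open Matrix

noncomputable def rowSub {m n : ℕ} (H : Matrix (Fin m) (Fin n) ℂ) (S : Finset (Fin m)) :
    Matrix S (Fin n) ℂ := fun i j => H i.1 j

noncomputable def Cap {m n : ℕ} (c : ℝ) (H : Matrix (Fin m) (Fin n) ℂ) (S : Finset (Fin m)) : ℝ :=
  Real.log (((1 + (c : ℂ) • (rowSub H S * (rowSub H S)ᴴ)).det).re)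

open scoped ComplexOrder

/-- Inversion is antitone on positive definite matrices for the Loewner order. -/
theorem Matrix.PosDef.posSemidef_inv_sub_inv {n : Type*} [Fintype n] [DecidableEq n]
    {A B : Matrix n n ℂ} (hA : A.PosDef) (hB : B.PosDef) (h : (B - A).PosSemidef) :
    (A⁻¹ - B⁻¹).PosSemidef := by
  have hAu : IsUnit A.det := (isUnit_iff_isUnit_det A).1 hA.isUnit
  have hBu : IsUnit B.det := (isUnit_iff_isUnit_det B).1 hB.isUnit
  have h₁ := hA.posSemidef.conjTranspose_mul_mul_same (A⁻¹ - B⁻¹)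
  have h₂ := h.conjTranspose_mul_mul_same B⁻¹
  rw [conjTranspose_sub, hA.inv.isHermitian.eq, hB.inv.isHermitian.eq] at h₁
  rw [hB.inv.isHermitian.eq] at h₂
  convert h₁.add h₂ using 1
  simp only [sub_mul, mul_sub, nonsing_inv_mul _ hAu, nonsing_inv_mul _ hBu, one_mul,
    mul_assoc, mul_nonsing_inv _ hAu, mul_one]
  abel

/-- The transmit-side matrix `I + c H_S† H_S`, written as a sum over the rows in `S`. -/
noncomputable def rowGram {m n : ℕ} (c : ℝ) (H : Matrix (Fin m) (Fin n) ℂ) (S : Finset (Fin m)) :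
    Matrix (Fin n) (Fin n) ℂ :=
  1 + ∑ i ∈ S, (c : ℂ) • vecMulVec (star (H i)) (H i)

section rowGram

variable {m n : ℕ} {c : ℝ} (H : Matrix (Fin m) (Fin n) ℂ)

theorem cap_eq_log_det_rowGram (c : ℝ) (S : Finset (Fin m)) :
    Cap c H S = Real.log (rowGram c H S).det.re := by
  have key : rowGram c H S = 1 + (rowSub H S)ᴴ * ((c : ℂ) • rowSub H S) := by
    ext j k
    simp only [rowGram, Matrix.add_apply, Matrix.sum_apply, Matrix.smul_apply, vecMulVec_apply,
      mul_apply, rowSub, conjTranspose_apply, Pi.star_apply, smul_eq_mul]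
    rw [← Finset.sum_coe_sort S]
    congr 1
    exact Finset.sum_congr rfl fun i _ => by ring
  rw [Cap, key, det_one_add_mul_comm, smul_mul]

variable {H}

theorem rowGram_insert {S : Finset (Fin m)} {a : Fin m} (ha : a ∉ S) :
    rowGram c H (insert a S) = rowGram c H S + (c : ℂ) • vecMulVec (star (H a)) (H a) := by
  rw [rowGram, rowGram, Finset.sum_insert ha]
  abel

theorem posSemidef_sum_smul_vecMulVec (hc : 0 ≤ c) (S : Finset (Fin m)) :
    (∑ i ∈ S, (c : ℂ) • vecMulVec (star (H i)) (H i)).PosSemidef :=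
  posSemidef_sum S fun i _ =>
    (posSemidef_vecMulVec_star_self (H i)).smul (Complex.zero_le_real.2 hc)

theorem posDef_rowGram (hc : 0 ≤ c) (S : Finset (Fin m)) : (rowGram c H S).PosDef :=
  PosDef.one.add_posSemidef (posSemidef_sum_smul_vecMulVec hc S)

theorem posSemidef_rowGram_sub_rowGram (hc : 0 ≤ c) {S T : Finset (Fin m)} (hST : S ⊆ T) :
    (rowGram c H T - rowGram c H S).PosSemidef := by
  rw [rowGram, rowGram, ← Finset.sum_sdiff hST, add_sub_add_left_eq_sub, add_sub_cancel_right]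
  exact posSemidef_sum_smul_vecMulVec hc _

theorem det_rowGram_insert (hc : 0 ≤ c) {S : Finset (Fin m)} {a : Fin m} (ha : a ∉ S) :
    (rowGram c H (insert a S)).det =
      (rowGram c H S).det * (1 + c * (H a ⬝ᵥ (rowGram c H S)⁻¹ *ᵥ star (H a))) := by
  have hu : IsUnit (rowGram c H S).det :=
    (isUnit_iff_isUnit_det _).1 (posDef_rowGram hc S).isUnit
  rw [rowGram_insert ha, ← smul_vecMulVec, vecMulVec_eq Unit,
    det_add_replicateCol_mul_replicateRow hu, det_unique (n := Unit),
    Matrix.mul_assoc, ← replicateCol_mulVec, Matrix.add_apply, one_apply_eq,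
    replicateRow_mul_replicateCol_apply, mulVec_smul, dotProduct_smul, smul_eq_mul]

theorem cap_insert_sub_cap (hc : 0 ≤ c) {S : Finset (Fin m)} {a : Fin m} (ha : a ∉ S) :
    Cap c H (insert a S) - Cap c H S =
      Real.log (1 + c * (H a ⬝ᵥ (rowGram c H S)⁻¹ *ᵥ star (H a)).re) := by
  have hS := Complex.pos_iff.1 (posDef_rowGram (H := H) hc S).det_pos
  have ha' := (posDef_rowGram (H := H) hc S).inv.posSemidef.dotProduct_mulVec_nonneg (star (H a))
  rw [star_star] at ha'
  have hq := mul_nonneg hc (Complex.nonneg_iff.1 ha').1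
  rw [cap_eq_log_det_rowGram, cap_eq_log_det_rowGram, det_rowGram_insert hc ha, Complex.mul_re,
    ← hS.2, zero_mul, sub_zero, Complex.add_re, Complex.one_re, Complex.re_ofReal_mul,
    Real.log_mul hS.1.ne' (by positivity), add_sub_cancel_left]

end rowGram

/-- The MIMO capacity function `C(S) = log det(I + (P/N_t) H_S H_S†)` is submodular. -/
theorem cap_submodular {Nr Nt : ℕ} (hNt : 0 < Nt) (H : Matrix (Fin Nr) (Fin Nt) ℂ)
    (P : ℝ) (hP : 0 < P) (S T : Finset (Fin Nr)) (hST : S ⊆ T) (a : Fin Nr) (ha : a ∉ T) :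
    Cap (P / Nt) H (insert a T) - Cap (P / Nt) H T ≤
      Cap (P / Nt) H (insert a S) - Cap (P / Nt) H S := by
  have hc : 0 ≤ P / Nt := by positivity
  have hST' := ((posDef_rowGram hc S).posSemidef_inv_sub_inv (posDef_rowGram hc T)
    (posSemidef_rowGram_sub_rowGram (H := H) hc hST)).dotProduct_mulVec_nonneg (star (H a))
  have hT := (posDef_rowGram (H := H) hc T).inv.posSemidef.dotProduct_mulVec_nonneg (star (H a))
  rw [star_star] at hST' hT
  rw [sub_mulVec, dotProduct_sub, sub_nonneg] at hST'
  have hq := mul_nonneg hc (Complex.nonneg_iff.1 hT).1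
  rw [cap_insert_sub_cap hc ha, cap_insert_sub_cap hc fun h => ha (hST h)]
  gcongr
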